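/- arXiv:0912.5196 — 3 statements merged into one kernel-verified Lean document; each statement's English description precedes it below -/
import Mathlib

section
/- (Commutator of a directional derivative with a difference-quotient operator.) Let u ∈ ℂ^N, let v ∈ ℝ^N \ {0} viewed in ℂ^N, and let f ∈ ℂ[z_1,…,z_N]. Define ρ_v f(z) = (f(z) − f(zσ_v))/(z, v) and the directional derivative ⟨∇, u⟩f(z) = ⟨∇f(z), u⟩. Then for every z ∈ ℂ^N with (z, v) ≠ 0: ⟨∇, u⟩ρ_v f(z) − ρ_v⟨∇, u⟩f(z) = (⟨v, u⟩/(z, v)) · ( 2⟨∇f(zσ_v), v⟩/⟨v, v⟩ − (f(z) − f(zσ_v))/(z, v) ). -/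
open MvPolynomial

noncomputable section

/-- The bilinear extension `(z, w) = Σ_j z_j w_j` of the Euclidean inner product to `ℂ^N`. -/
def bilinC {N : ℕ} (z w : Fin N → ℂ) : ℂ := ∑ j, z j * w j

/-- The Hermitian extension `⟨z, w⟩ = Σ_j z_j conj(w_j)` of the Euclidean inner product. -/
def hermC {N : ℕ} (z w : Fin N → ℂ) : ℂ := ∑ j, z j * (starRingEnd ℂ) (w j)

/-- The standard embedding `ℝ^N ↪ ℂ^N`. -/
def cplx {N : ℕ} (v : Fin N → ℝ) : Fin N → ℂ := fun j => (v j : ℂ)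

/-- The reflection `zσ_v = z − 2((z,v)/‖v‖²) v` on `ℂ^N`, for `v ∈ ℝ^N`. -/
def reflC {N : ℕ} (v : Fin N → ℝ) (z : Fin N → ℂ) : Fin N → ℂ :=
  z - (2 * bilinC z (cplx v) / bilinC (cplx v) (cplx v)) • cplx v

/-- The complex gradient of a polynomial, at a point. -/
def gradAt {N : ℕ} (p : MvPolynomial (Fin N) ℂ) (z : Fin N → ℂ) : Fin N → ℂ :=
  fun j => eval z (pderiv j p)

/-- The directional derivative `⟨∇, u⟩F(z) = ⟨∇F(z), u⟩ = Σ_j (∂F/∂z_j)(z)·conj(u_j)`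
of a (holomorphic) function `F : ℂ^N → ℂ`, expressed via the Fréchet derivative
applied to the direction `(conj u_1, …, conj u_N)`. -/
def dirDeriv {N : ℕ} (u : Fin N → ℂ) (F : (Fin N → ℂ) → ℂ) (z : Fin N → ℂ) : ℂ :=
  fderiv ℂ F z (fun j => (starRingEnd ℂ) (u j))

theorem hasFDerivAt_evalC {N : ℕ} (p : MvPolynomial (Fin N) ℂ) (z : Fin N → ℂ) :
    HasFDerivAt (fun w : Fin N → ℂ => eval w p)
      (∑ j, eval z (pderiv j p) • (ContinuousLinearMap.proj j : (Fin N → ℂ) →L[ℂ] ℂ)) z := by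
  induction p using MvPolynomial.induction_on with
  | C a => 
    simp only [eval_C]
    refine (hasFDerivAt_const (𝕜 := ℂ) a z).congr_fderiv ?_
    ext w
    simp
  | add p q hp hq =>
    simp only [map_add]
    refine (hp.fun_add hq).congr_fderiv ?_
    ext w
    simp [add_mul, Finset.sum_add_distrib]
  | mul_X p i hp =>
    have h := hp.mul (ContinuousLinearMap.proj (R := ℂ) (φ := fun _ : Fin N => ℂ) i).hasFDerivAt
    simp only [map_mul, eval_X]
    refine h.congr_fderiv ?_
    ext w
    simp [Derivation.leibniz, pderiv_X, add_mul, Finset.sum_add_distrib, Finset.mul_sum,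
      Pi.single_apply, apply_ite, mul_assoc]

/-- `(·, a)` as a continuous linear map. -/
def bilinL {N : ℕ} (a : Fin N → ℂ) : (Fin N → ℂ) →L[ℂ] ℂ :=
  ∑ j, a j • (ContinuousLinearMap.proj j : (Fin N → ℂ) →L[ℂ] ℂ)

theorem bilinL_apply {N : ℕ} (a w : Fin N → ℂ) : bilinL a w = bilinC w a := by
  simp [bilinL, bilinC, mul_comm]

theorem hasFDerivAt_evalC' {N : ℕ} (p : MvPolynomial (Fin N) ℂ) (z : Fin N → ℂ) :
    HasFDerivAt (fun w : Fin N → ℂ => eval w p) (bilinL (gradAt p z)) z :=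
  hasFDerivAt_evalC p z

/-- The reflection as a continuous linear map. -/
def reflL {N : ℕ} (v : Fin N → ℝ) : (Fin N → ℂ) →L[ℂ] (Fin N → ℂ) :=
  ContinuousLinearMap.id ℂ _ -
    ((2 / bilinC (cplx v) (cplx v)) • bilinL (cplx v)).smulRight (cplx v)

theorem reflL_apply {N : ℕ} (v : Fin N → ℝ) (w : Fin N → ℂ) : reflL v w = reflC v w := by
  simp only [reflL, reflC, sub_apply, ContinuousLinearMap.id_apply,
    ContinuousLinearMap.smulRight_apply, smul_apply, bilinL_apply, smul_eq_mul]
  congr 2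
  ring

/-- commutator of a directional derivative with a difference-quotient
operator: for `u ∈ ℂ^N`, `v ∈ ℝ^N \ {0}`, a polynomial `f`, and `z` with `(z,v) ≠ 0`:
`⟨∇,u⟩ρ_v f(z) − ρ_v⟨∇,u⟩f(z)
   = (⟨v,u⟩/(z,v)) · (2⟨∇f(zσ_v), v⟩/⟨v,v⟩ − (f(z) − f(zσ_v))/(z,v))`,
where `ρ_v f(z) = (f(z) − f(zσ_v))/(z,v)`. -/
theorem stmt6 {N : ℕ} (u : Fin N → ℂ) (v : Fin N → ℝ) (hv : v ≠ 0)
    (f : MvPolynomial (Fin N) ℂ) (z : Fin N → ℂ) (hz : bilinC z (cplx v) ≠ 0) :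
    dirDeriv u (fun w => (eval w f - eval (reflC v w) f) / bilinC w (cplx v)) z
        - (hermC (gradAt f z) u - hermC (gradAt f (reflC v z)) u) / bilinC z (cplx v)
      = hermC (cplx v) u / bilinC z (cplx v) *
          (2 * hermC (gradAt f (reflC v z)) (cplx v) / hermC (cplx v) (cplx v)
            - (eval z f - eval (reflC v z) f) / bilinC z (cplx v)) := by
  have hc : bilinC (cplx v) (cplx v) = hermC (cplx v) (cplx v) := by
    simp [bilinC, hermC, cplx]
  have hF : HasFDerivAt (fun w => (eval w f - eval (reflC v w) f))
      (bilinL (gradAt f z) - (bilinL (gradAt f (reflC v z))).comp (reflL v)) z := by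
    refine (hasFDerivAt_evalC' f z).sub ?_
    have h1 := (reflL v).hasFDerivAt (x := z)
    have h2 := hasFDerivAt_evalC' f (reflL v z)
    have h3 := h2.comp z h1
    rw [reflL_apply] at h3
    refine h3.congr_of_eventuallyEq (Filter.Eventually.of_forall fun w => ?_)
    simp [reflL_apply]
  have hB : HasFDerivAt (fun w => bilinC w (cplx v)) (bilinL (cplx v)) z := by
    have h1 := (bilinL (cplx v)).hasFDerivAt (x := z)
    refine h1.congr_of_eventuallyEq (Filter.Eventually.of_forall fun w => ?_)
    simp [bilinL_apply]
  have hQ := hF.mul ((hasDerivAt_inv hz).comp_hasFDerivAt z hB)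
  have e : (fun w => (eval w f - eval (reflC v w) f) / bilinC w (cplx v))
      = (fun w => (eval w f - eval (reflC v w) f)) * (Inv.inv ∘ fun w => bilinC w (cplx v)) := by
    ext w
    simp [div_eq_mul_inv]
  have hh : ∀ a : Fin N → ℂ, bilinL a (fun j => (starRingEnd ℂ) (u j)) = hermC a u := by
    intro a
    simp [bilinL, hermC]
  have hh2 : ∀ a : Fin N → ℂ, bilinL a (cplx v) = hermC a (cplx v) := by
    intro a
    simp [bilinL, hermC, cplx]
  rw [dirDeriv, e, hQ.fderiv]
  simp only [add_apply, sub_apply,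
    smul_apply, ContinuousLinearMap.comp_apply, reflL,
    ContinuousLinearMap.id_apply, ContinuousLinearMap.smulRight_apply, map_sub, map_smul,
    Function.comp_apply, hh, hh2, hc, smul_eq_mul]
  field_simp
  ring
end
end

section
/- Let R ⊂ ℝ^N ⊂ ℂ^N be a root system with positive subsystem R_+, G the complex Coxeter group generated by {σ_v : v ∈ R}, and κ a G-invariant multiplicity function. Fix t, u ∈ ℂ^N and set B(v, s) = ⟨v, t⟩⟨s, u⟩ − ⟨v, u⟩⟨s, t⟩. Then for every polynomial f ∈ ℂ[z_1,…,z_N] and every z where the expressions are defined, Σ_{v, s ∈ R_+} κ_v κ_s B(v, s) ρ_v ρ_s f(z) = 0, where ρ_v f(z) = (f(z) − f(zσ_v))/(z, v). -/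
open MvPolynomial

noncomputable section

/-- The Euclidean inner product on `ℝ^N`. -/
def bilinR {N : ℕ} (x y : Fin N → ℝ) : ℝ := ∑ j, x j * y j

/-- The real reflection `σ_u(x) = x − 2(⟨x,u⟩/‖u‖²) u`. -/
def reflR {N : ℕ} (u x : Fin N → ℝ) : Fin N → ℝ :=
  x - (2 * bilinR x u / bilinR u u) • u

/-- The difference-quotient operator `ρ_v F(z) = (F(z) − F(zσ_v))/(z,v)` on functions. -/
def rhoFun {N : ℕ} (v : Fin N → ℝ) (F : (Fin N → ℂ) → ℂ) (z : Fin N → ℂ) : ℂ :=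
  (F z - F (reflC v z)) / bilinC z (cplx v)

/-- The form `B(v, s) = ⟨v, t⟩⟨s, u⟩ − ⟨v, u⟩⟨s, t⟩`. -/
def Bform {N : ℕ} (t u : Fin N → ℂ) (v s : Fin N → ℝ) : ℂ :=
  hermC (cplx v) t * hermC (cplx s) u - hermC (cplx v) u * hermC (cplx s) t


section helpers

variable {V : Type*} [AddCommGroup V] [Module ℝ V]

lemma hp_orbit {ι : Type*} [Fintype ι]
    (e : ι → V) (P Q X : V →ₗ[ℝ] ℂ) (r : ι → ι → ι) (c : ι → ι → ℝ)
    (hr : ∀ v s, r v (r v s) = s)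
    (he : ∀ v s, e (r v s) = e s - c v s • e v)
    (k : ι → ℂ) (hk : ∀ v s, k (r v s) = k s)
    (hX : ∀ v, X (e v) ≠ 0)
    (φ : ι → ι → ℂ) (hφ : ∀ v s, φ s (r s v) = φ v s) :
    ∑ p : ι × ι, (k p.1 * k p.2 * φ p.1 p.2) *
      ((P (e p.1) * Q (e p.2) - Q (e p.1) * P (e p.2)) / (X (e p.1) * X (e p.2))) = 0 := by
  classical
  let τ : Equiv.Perm (ι × ι) :=
    { toFun := fun p => (p.2, r p.2 p.1)
      invFun := fun p => (r p.1 p.2, p.1)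
      left_inv := fun p => by simp [hr]
      right_inv := fun p => by simp [hr] }
  have hτ : ∀ p, τ p = (p.2, r p.2 p.1) := fun p => rfl
  let F : ι → ι → ℂ := fun v s =>
    (P (e v) * Q (e s) - Q (e v) * P (e s)) / (X (e v) * X (e s))
  let W : ι × ι → ℂ := fun p => k p.1 * k p.2 * φ p.1 p.2
  have hW : ∀ p (i : ℕ), W ((τ ^ i) p) = W p := by
    intro p i
    induction i with
    | zero => simp
    | succ i ih =>
      rw [pow_succ', Equiv.Perm.mul_apply, ← ih, hτ]
      simp only [W, hk, hφ]
      ring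
  let n := orderOf τ
  have hn : 0 < n := orderOf_pos τ
  have hspan : ∀ (p : ι × ι) (i : ℕ),
      (∃ a b : ℝ, e ((τ ^ i) p).1 = a • e p.1 + b • e p.2) ∧
      (∃ a b : ℝ, e ((τ ^ i) p).2 = a • e p.1 + b • e p.2) := by
    intro p i
    induction i with
    | zero => exact ⟨⟨1, 0, by simp⟩, ⟨0, 1, by simp⟩⟩
    | succ i ih =>
      obtain ⟨⟨a, b, h1⟩, ⟨a', b', h2⟩⟩ := ih
      rw [pow_succ', Equiv.Perm.mul_apply, hτ]
      refine ⟨⟨a', b', h2⟩, ?_⟩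
      set q := (τ ^ i) p
      refine ⟨a - c q.2 q.1 * a', b - c q.2 q.1 * b', ?_⟩
      simp only [he, h1, h2]
      module
  have hF : ∀ (p : ι × ι) (i : ℕ), F ((τ ^ i) p).1 ((τ ^ i) p).2 =
      F ((τ ^ i) p).1 p.1 - F ((τ ^ (i+1)) p).1 p.1 := by
    intro p i
    obtain ⟨⟨a, b, h1⟩, ⟨a', b', h2⟩⟩ := hspan p i
    rw [pow_succ', Equiv.Perm.mul_apply, hτ]
    set q := (τ ^ i) p
    have n1 := hX q.1
    have n2 := hX q.2
    have n3 := hX p.1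
    simp only [F]
    rw [div_sub_div _ _ (by positivity) (by positivity), div_eq_div_iff (by positivity) (by positivity)]
    simp only [h1, h2, map_add, map_smul, Complex.real_smul]
    ring
  have htel : ∀ p : ι × ι, ∑ i ∈ Finset.range n, F ((τ ^ i) p).1 ((τ ^ i) p).2 = 0 := by
    intro p
    simp only [hF]
    rw [Finset.sum_range_sub' (fun i => F ((τ ^ i) p).1 p.1) n]
    simp [n, pow_orderOf_eq_one]
  have key : (n : ℂ) * ∑ p : ι × ι, W p * F p.1 p.2 = 0 := by
    have h1 : ∀ i ∈ Finset.range n, ∑ p : ι × ι, W p * F p.1 p.2 =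
        ∑ p : ι × ι, W p * F ((τ ^ i) p).1 ((τ ^ i) p).2 := by
      intro i _
      rw [← Equiv.sum_comp (τ ^ i)]
      simp only [hW]
    have h2 : (n : ℂ) * ∑ p : ι × ι, W p * F p.1 p.2 =
        ∑ i ∈ Finset.range n, ∑ p : ι × ι, W p * F p.1 p.2 := by simp
    rw [h2, Finset.sum_congr rfl h1, Finset.sum_comm]
    simp only [← Finset.mul_sum, htel, mul_zero, Finset.sum_const_zero]
  have hn' : (n : ℂ) ≠ 0 := by exact_mod_cast hn.ne'
  exact (mul_eq_zero.mp key).resolve_left hn'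

lemma hp_total {ι : Type*} [Fintype ι]
    (e : ι → V) (P Q X : V →ₗ[ℝ] ℂ) (r : ι → ι → ι) (c : ι → ι → ℝ)
    (hr : ∀ v s, r v (r v s) = s)
    (he : ∀ v s, e (r v s) = e s - c v s • e v)
    (k : ι → ℂ) (hk : ∀ v s, k (r v s) = k s)
    (hX : ∀ v, X (e v) ≠ 0)
    (c0 : ℂ) (f1 : ι → ℂ)
    (φ : ι → ι → ℂ) (hφ : ∀ v s, φ s (r s v) = φ v s) :
    ∑ v, ∑ s, k v * k s * (P (e v) * Q (e s) - Q (e v) * P (e s)) *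
      (((c0 - f1 s) / X (e s) - (f1 v - φ v s) / X (e (r v s))) / X (e v)) = 0 := by
  let F : ι → ι → ℂ := fun v s =>
    (P (e v) * Q (e s) - Q (e v) * P (e s)) / (X (e v) * X (e s))
  have hFa : ∀ v s, F s v = - F v s := by
    intro v s
    simp only [F]
    rw [mul_comm (X (e s)), ← neg_div]
    congr 1
    ring
  have step : ∀ v, ∑ s, k v * k s * (P (e v) * Q (e s) - Q (e v) * P (e s)) *
      (((c0 - f1 s) / X (e s) - (f1 v - φ v s) / X (e (r v s))) / X (e v)) =
      ∑ s, k v * k s * F v s * (c0 - f1 s - f1 v + φ s v) := by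
    intro v
    let E : Equiv.Perm ι := ⟨r v, r v, hr v, hr v⟩
    have hE : ∀ s, E s = r v s := fun s => rfl
    have h1 : ∑ s, k v * k s * (P (e v) * Q (e s) - Q (e v) * P (e s)) *
        ((f1 v - φ v s) / X (e (r v s)) / X (e v)) =
        ∑ s, k v * k s * F v s * (f1 v - φ s v) := by
      rw [← Equiv.sum_comp E]
      refine Finset.sum_congr rfl fun s _ => ?_
      rw [hE, hr, hk, hφ s v]
      simp only [F, he, map_sub, map_smul, Complex.real_smul]
      have := hX v
      have := hX s
      field_simp
      ring
    have h2 : ∑ s, k v * k s * (P (e v) * Q (e s) - Q (e v) * P (e s)) *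
        ((c0 - f1 s) / X (e s) / X (e v)) =
        ∑ s, k v * k s * F v s * (c0 - f1 s) := by
      refine Finset.sum_congr rfl fun s _ => ?_
      simp only [F]
      have := hX v
      have := hX s
      field_simp
    have h3 : ∑ s, k v * k s * F v s * (c0 - f1 s - f1 v + φ s v) =
        ∑ s, k v * k s * F v s * (c0 - f1 s) - ∑ s, k v * k s * F v s * (f1 v - φ s v) := by
      rw [← Finset.sum_sub_distrib]
      exact Finset.sum_congr rfl fun s _ => by ring
    rw [h3, ← h1, ← h2, ← Finset.sum_sub_distrib]
    exact Finset.sum_congr rfl fun s _ => by ring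
  rw [Finset.sum_congr rfl fun v _ => step v]
  have hsym : ∑ v, ∑ s, k v * k s * F v s * (c0 - f1 s - f1 v) = 0 := by
    have h : ∑ v, ∑ s, k v * k s * F v s * (c0 - f1 s - f1 v) =
        - ∑ v, ∑ s, k v * k s * F v s * (c0 - f1 s - f1 v) := by
      conv_lhs => rw [Finset.sum_comm]
      simp only [← Finset.sum_neg_distrib]
      refine Finset.sum_congr rfl fun v _ => Finset.sum_congr rfl fun s _ => ?_
      rw [hFa v s]
      ring
    exact self_eq_neg.mp h
  have hA : ∑ v, ∑ s, k v * k s * F v s * φ s v = 0 := by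
    have h := hp_orbit e P Q X r c hr he k hk hX φ hφ
    rw [Fintype.sum_prod_type, Finset.sum_comm] at h
    rw [← neg_eq_zero, ← h]
    simp only [← Finset.sum_neg_distrib]
    refine Finset.sum_congr rfl fun v _ => Finset.sum_congr rfl fun s _ => ?_
    have := hFa v s
    simp only [F] at this ⊢
    rw [this]
    ring
  simp only [mul_add, Finset.sum_add_distrib, hA, hsym, add_zero]

end helpers

section concrete

variable {N : ℕ}

/-- Bilinear pairing with a fixed complex vector, as a real-linear map. -/
def hpX (z : Fin N → ℂ) : (Fin N → ℝ) →ₗ[ℝ] ℂ where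
  toFun v := bilinC z (cplx v)
  map_add' v w := by simp [bilinC, cplx, mul_add, Finset.sum_add_distrib]
  map_smul' a v := by
    simp only [bilinC, cplx, Pi.smul_apply, smul_eq_mul, Complex.ofReal_mul, RingHom.id_apply,
      Complex.real_smul, Finset.mul_sum]
    exact Finset.sum_congr rfl fun _ _ => by ring

/-- Hermitian pairing with a fixed complex vector, as a real-linear map. -/
def hpH (t : Fin N → ℂ) : (Fin N → ℝ) →ₗ[ℝ] ℂ where
  toFun v := hermC (cplx v) t
  map_add' v w := by simp [hermC, cplx, add_mul, Finset.sum_add_distrib]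
  map_smul' a v := by
    simp only [hermC, cplx, Pi.smul_apply, smul_eq_mul, Complex.ofReal_mul, RingHom.id_apply,
      Complex.real_smul, Finset.mul_sum]
    exact Finset.sum_congr rfl fun _ _ => by ring

lemma hp_self_ne {v : Fin N → ℝ} (hv : v ≠ 0) : bilinR v v ≠ 0 := by
  intro h
  apply hv
  funext j
  have := (Finset.sum_eq_zero_iff_of_nonneg (fun j _ => mul_self_nonneg (v j))).mp h j
    (Finset.mem_univ j)
  simpa using this

lemma hp_cast (v w : Fin N → ℝ) : bilinC (cplx v) (cplx w) = (bilinR v w : ℂ) := by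
  simp [bilinC, bilinR, cplx]

lemma hp_sub_smul_left (z y w : Fin N → ℂ) (a : ℂ) :
    bilinC (z - a • y) w = bilinC z w - a * bilinC y w := by
  simp only [bilinC, Pi.sub_apply, Pi.smul_apply, smul_eq_mul, sub_mul, Finset.sum_sub_distrib,
    Finset.mul_sum, mul_assoc]

lemma hp_sub_smul_leftR (z y w : Fin N → ℝ) (a : ℝ) :
    bilinR (z - a • y) w = bilinR z w - a * bilinR y w := by
  simp only [bilinR, Pi.sub_apply, Pi.smul_apply, smul_eq_mul, sub_mul, Finset.sum_sub_distrib,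
    Finset.mul_sum, mul_assoc]

lemma hp_commC (z w : Fin N → ℂ) : bilinC z w = bilinC w z := by
  simp only [bilinC, mul_comm]

lemma hp_commR (z w : Fin N → ℝ) : bilinR z w = bilinR w z := by
  simp only [bilinR, mul_comm]

lemma hp_cplx_refl (v s : Fin N → ℝ) : cplx (reflR v s) = reflC v (cplx s) := by
  funext j
  simp only [reflR, reflC, hp_cast]
  simp [cplx]

lemma hp_adj (v s : Fin N → ℝ) (z : Fin N → ℂ) :
    bilinC (reflC v z) (cplx s) = bilinC z (cplx (reflR v s)) := by
  rw [hp_cplx_refl, hp_commC z]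
  simp only [reflC, hp_sub_smul_left]
  rw [hp_commC (cplx s) z, hp_commC (cplx s) (cplx v), hp_commC (cplx v) z]
  ring

lemma hp_invol {v : Fin N → ℝ} (hv : v ≠ 0) (s : Fin N → ℝ) : reflR v (reflR v s) = s := by
  have h := hp_self_ne hv
  have : bilinR (reflR v s) v = - bilinR s v := by
    rw [reflR, hp_sub_smul_leftR]; field_simp; ring
  conv_lhs => rw [reflR, this]
  rw [reflR]
  funext j
  simp only [Pi.sub_apply, Pi.smul_apply, smul_eq_mul]
  ring

lemma hp_involC {v : Fin N → ℝ} (hv : v ≠ 0) (s : Fin N → ℂ) : reflC v (reflC v s) = s := by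
  have h : bilinC (cplx v) (cplx v) ≠ 0 := by
    rw [hp_cast]; exact_mod_cast hp_self_ne hv
  have : bilinC (reflC v s) (cplx v) = - bilinC s (cplx v) := by
    rw [reflC, hp_sub_smul_left]; field_simp; ring
  conv_lhs => rw [reflC, this]
  rw [reflC]
  funext j
  simp only [Pi.sub_apply, Pi.smul_apply, smul_eq_mul]
  ring

lemma hp_refl_self {v : Fin N → ℝ} (hv : v ≠ 0) : reflR v v = -v := by
  have h := hp_self_ne hv
  rw [reflR, mul_div_assoc, div_self h]
  module

lemma hp_norm {v : Fin N → ℝ} (hv : v ≠ 0) (s : Fin N → ℝ) :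
    bilinR (reflR v s) (reflR v s) = bilinR s s := by
  have h := hp_self_ne hv
  rw [reflR, hp_sub_smul_leftR, hp_commR s (s - _), hp_commR v (s - _), hp_sub_smul_leftR,
    hp_sub_smul_leftR, hp_commR v s]
  field_simp
  ring

/-- Conjugation: `σ_{vσ_s}` after `σ_s` equals `σ_s` after `σ_v`. -/
lemma hp_conj {s : Fin N → ℝ} (hs : s ≠ 0) (v : Fin N → ℝ) (z : Fin N → ℂ) :
    reflC (reflR s v) (reflC s z) = reflC s (reflC v z) := by
  have hn : bilinC (cplx (reflR s v)) (cplx (reflR s v)) = bilinC (cplx v) (cplx v) := by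
    rw [hp_cast, hp_cast, hp_norm hs]
  have h1 : bilinC (reflC s z) (cplx (reflR s v)) = bilinC z (cplx v) := by
    rw [hp_adj, hp_invol hs]
  conv_lhs => rw [reflC, hn, h1, hp_cplx_refl]
  conv_rhs => rw [reflC, reflC, hp_sub_smul_left]
  rw [reflC, reflC]
  funext j
  simp only [Pi.sub_apply, Pi.smul_apply, smul_eq_mul]
  ring

lemma hp_cplx_neg (v : Fin N → ℝ) : cplx (-v) = - cplx v := by
  funext j; simp [cplx]

lemma hp_bilin_neg (z w : Fin N → ℂ) : bilinC z (-w) = - bilinC z w := by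
  simp [bilinC]

lemma hp_bilin_neg' (z w : Fin N → ℂ) : bilinC (-z) w = - bilinC z w := by
  simp [bilinC]

lemma hp_reflC_neg (v : Fin N → ℝ) (z : Fin N → ℂ) : reflC (-v) z = reflC v z := by
  simp only [reflC, hp_cplx_neg, hp_bilin_neg, hp_bilin_neg', neg_neg]
  funext j
  simp only [Pi.sub_apply, Pi.smul_apply, smul_eq_mul, Pi.neg_apply]
  ring

lemma hp_rho_neg (v : Fin N → ℝ) (F : (Fin N → ℂ) → ℂ) (z : Fin N → ℂ) :
    rhoFun (-v) F z = - rhoFun v F z := by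
  simp only [rhoFun, hp_reflC_neg, hp_cplx_neg, hp_bilin_neg, div_neg]

lemma hp_herm_neg (v : Fin N → ℝ) (t : Fin N → ℂ) :
    hermC (cplx (-v)) t = - hermC (cplx v) t := by
  simp [hermC, cplx]

lemma hp_double (R Rp : Finset (Fin N → ℝ))
    (hRpos : ∀ u : Fin N → ℝ, u ∈ R ↔ u ∈ Rp ∨ -u ∈ Rp)
    (hRpdisj : ∀ u ∈ Rp, -u ∉ Rp) (g : (Fin N → ℝ) → ℂ) (hg : ∀ v ∈ Rp, g (-v) = g v) :
    ∑ v ∈ R, g v = 2 * ∑ v ∈ Rp, g v := by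
  classical
  have hR : R = Rp ∪ Rp.image (fun v => -v) := by
    ext v
    rw [hRpos, Finset.mem_union, Finset.mem_image]
    refine or_congr Iff.rfl ⟨fun h => ⟨-v, h, neg_neg v⟩, ?_⟩
    rintro ⟨w, hw, rfl⟩
    simpa using hw
  have hd : Disjoint Rp (Rp.image (fun v => -v)) := by
    rw [Finset.disjoint_left]
    intro v hv hv'
    obtain ⟨w, hw, rfl⟩ := Finset.mem_image.mp hv'
    exact hRpdisj w hw hv
  rw [hR, Finset.sum_union hd, Finset.sum_image (fun a _ b _ h => neg_injective h),
    Finset.sum_congr rfl hg]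
  ring

end concrete

/-- for a root system `R ⊂ ℝ^N ⊂ ℂ^N` with positive subsystem `R₊` and a
multiplicity function `κ` invariant under the complex Coxeter group (equivalently, under
its generating reflections), fixing `t, u ∈ ℂ^N`,
`Σ_{v,s ∈ R₊} κ_v κ_s B(v,s) ρ_v ρ_s f(z) = 0`
for every polynomial `f` and every `z` where the expressions are defined. -/
theorem stmt8 {N : ℕ} (R Rp : Finset (Fin N → ℝ)) (κ : (Fin N → ℝ) → ℂ)
    (hR0 : (0 : Fin N → ℝ) ∉ R)
    (hRrefl : ∀ u ∈ R, ∀ x ∈ R, reflR u x ∈ R)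
    (hRline : ∀ u ∈ R, ∀ x ∈ R, (∃ c : ℝ, x = c • u) → x = u ∨ x = -u)
    (hRneg : ∀ u ∈ R, -u ∈ R)
    (hRpos : ∀ u : Fin N → ℝ, u ∈ R ↔ u ∈ Rp ∨ -u ∈ Rp)
    (hRpdisj : ∀ u ∈ Rp, -u ∉ Rp)
    (hκ : ∀ u ∈ R, ∀ w ∈ R, κ (reflR w u) = κ u)
    (t u : Fin N → ℂ) (f : MvPolynomial (Fin N) ℂ) (z : Fin N → ℂ)
    (hz1 : ∀ v ∈ Rp, bilinC z (cplx v) ≠ 0)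
    (hz2 : ∀ v ∈ Rp, ∀ s ∈ Rp, bilinC (reflC s z) (cplx v) ≠ 0) :
    ∑ v ∈ Rp, ∑ s ∈ Rp,
      κ v * κ s * Bform t u v s * rhoFun v (rhoFun s (fun w => eval w f)) z = 0 := by
  have hne : ∀ v ∈ R, v ≠ 0 := fun v hv h => hR0 (h ▸ hv)
  have hRp : ∀ v ∈ Rp, v ∈ R := fun v hv => (hRpos v).mpr (Or.inl hv)
  have hκn : ∀ v ∈ R, κ (-v) = κ v := fun v hv => by
    rw [← hp_refl_self (hne v hv)]; exact hκ v hv v hv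
  have hX : ∀ v ∈ R, bilinC z (cplx v) ≠ 0 := by
    intro v hv
    rcases (hRpos v).mp hv with h | h
    · exact hz1 v h
    · have := hz1 _ h
      rw [hp_cplx_neg, hp_bilin_neg] at this
      exact neg_ne_zero.mp this
  set g : (Fin N → ℝ) → (Fin N → ℝ) → ℂ := fun v s =>
    κ v * κ s * Bform t u v s * rhoFun v (rhoFun s (fun w => eval w f)) z with hg
  have hg1 : ∀ v ∈ Rp, ∀ s, g (-v) s = g v s := by
    intro v hv s
    simp only [hg, hκn v (hRp v hv), hp_rho_neg, Bform, hp_herm_neg]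
    ring
  have hg2 : ∀ v, ∀ s ∈ Rp, g v (-s) = g v s := by
    intro v s hs
    have : rhoFun (-s) (fun w => eval w f) = fun z => - rhoFun s (fun w => eval w f) z := by
      funext z; exact hp_rho_neg _ _ _
    have h2 : rhoFun v (fun z => - rhoFun s (fun w => eval w f) z) z =
        - rhoFun v (rhoFun s (fun w => eval w f)) z := by
      simp only [rhoFun]; ring
    simp only [hg, hκn s (hRp s hs), this, h2, Bform, hp_herm_neg]
    ring
  have hsum : ∑ v ∈ R, ∑ s ∈ R, g v s = 4 * ∑ v ∈ Rp, ∑ s ∈ Rp, g v s := by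
    rw [hp_double R Rp hRpos hRpdisj]
    · rw [Finset.sum_congr rfl fun v _ => hp_double R Rp hRpos hRpdisj (g v) (hg2 v),
        ← Finset.mul_sum]
      ring
    · intro v hv
      exact Finset.sum_congr rfl fun s _ => hg1 v hv s
  have hzero : ∑ v ∈ R, ∑ s ∈ R, g v s = 0 := by
    have h := hp_total (ι := {x // x ∈ R}) (fun v => v.1) (hpH t) (hpH u) (hpX z)
      (fun v s => ⟨reflR v.1 s.1, hRrefl v.1 v.2 s.1 s.2⟩)
      (fun v s => 2 * bilinR s.1 v.1 / bilinR v.1 v.1)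
      (fun v s => Subtype.ext (hp_invol (hne v.1 v.2) s.1))
      (fun v s => rfl)
      (fun v => κ v.1)
      (fun v s => hκ s.1 s.2 v.1 v.2)
      (fun v => hX v.1 v.2)
      (eval z f) (fun v => eval (reflC v.1 z) f)
      (fun v s => eval (reflC s.1 (reflC v.1 z)) f)
      (fun v s => by simp only [hp_conj (hne s.1 s.2)])
    rw [← Finset.sum_coe_sort R]
    rw [← h]
    refine Finset.sum_congr rfl fun v _ => ?_
    rw [← Finset.sum_coe_sort R]
    refine Finset.sum_congr rfl fun s _ => ?_
    simp only [hg, rhoFun, hp_adj, Bform]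
    rfl
  rw [hsum] at hzero
  exact (mul_eq_zero.mp hzero).resolve_left (by norm_num)
end
end

section
/- (Main theorem: commutativity of complex Dunkl operators.) Let R ⊂ ℂ^N be a root system satisfying R ⊂ ℝ^N with positive subsystem R_+, G the complex Coxeter group generated by {σ_v : v ∈ R}, and κ a G-invariant multiplicity function. Then the complex Dunkl operators commute: for all t, u ∈ ℂ^N and all polynomials f ∈ ℂ[z_1,…,z_N], 𝒟_t 𝒟_u f(z) = 𝒟_u 𝒟_t f(z) for every z ∈ ℂ^N. -/
open MvPolynomial

noncomputable section

/-- The linear polynomial `z ↦ (z, v)`. -/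
def linPoly {N : ℕ} (v : Fin N → ℝ) : MvPolynomial (Fin N) ℂ :=
  ∑ i, C ((v i : ℂ)) * X i

/-- The polynomial `z ↦ p(zσ_v)`. -/
def reflPoly {N : ℕ} (v : Fin N → ℝ) (p : MvPolynomial (Fin N) ℂ) : MvPolynomial (Fin N) ℂ :=
  aeval (fun j => X j - C (((2 * v j / bilinR v v : ℝ) : ℂ)) * linPoly v) p

/-- The difference-quotient operator `ρ_v p = (p − p∘σ_v)/( · , v)` on polynomials:
the (unique, as the quotient by a nonzero linear polynomial) polynomial `q` with
`p − p∘σ_v = (·,v) · q`. -/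
def rhoPoly {N : ℕ} (v : Fin N → ℝ) (p : MvPolynomial (Fin N) ℂ) : MvPolynomial (Fin N) ℂ :=
  letI := Classical.dec (linPoly v ∣ (p - reflPoly v p))
  if h : linPoly v ∣ (p - reflPoly v p) then h.choose else 0

/-- The complex Dunkl operator `𝒟_u p = ⟨∇p, u⟩ + Σ_{v ∈ R₊} κ_v (ρ_v p) ⟨v, u⟩`
on polynomials; since `ρ_v p` is a polynomial, `𝒟_u p` is again a polynomial. -/
def dunklU {N : ℕ} (Rp : Finset (Fin N → ℝ)) (κ : (Fin N → ℝ) → ℂ) (u : Fin N → ℂ)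
    (p : MvPolynomial (Fin N) ℂ) : MvPolynomial (Fin N) ℂ :=
  (∑ j, C ((starRingEnd ℂ) (u j)) * pderiv j p)
    + ∑ v ∈ Rp, C (κ v * hermC (cplx v) u) * rhoPoly v p

lemma bR_comm {N : ℕ} (x y : Fin N → ℝ) : bilinR x y = bilinR y x := by
  simp only [bilinR, mul_comm]

lemma bR_sub {N : ℕ} (x y z : Fin N → ℝ) : bilinR x (y - z) = bilinR x y - bilinR x z := by
  simp only [bilinR, ← Finset.sum_sub_distrib, Pi.sub_apply, mul_sub]

lemma bR_smul {N : ℕ} (x y : Fin N → ℝ) (c : ℝ) : bilinR x (c • y) = c * bilinR x y := by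
  simp only [bilinR, Finset.mul_sum, Pi.smul_apply, smul_eq_mul]
  exact Finset.sum_congr rfl fun _ _ => by ring

lemma bR_self {N : ℕ} {x : Fin N → ℝ} (h : bilinR x x = 0) : x = 0 := by
  unfold bilinR at h
  rw [Finset.sum_eq_zero_iff_of_nonneg (fun i _ => mul_self_nonneg _)] at h
  ext i
  simpa using h i (Finset.mem_univ i)

lemma bR_refl {N : ℕ} (z v w : Fin N → ℝ) :
    bilinR z (reflR v w) = bilinR z w - (2 * bilinR w v / bilinR v v) * bilinR z v := by
  simp only [reflR, bR_sub, bR_smul]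

lemma bR_refl' {N : ℕ} (z v w : Fin N → ℝ) :
    bilinR (reflR v z) w = bilinR z (reflR v w) := by
  rw [bR_comm, bR_refl, bR_refl, bR_comm z v, bR_comm w z, bR_comm w v]; ring

lemma refl_refl {N : ℕ} (v x : Fin N → ℝ) (h : bilinR v v ≠ 0) : reflR v (reflR v x) = x := by
  have : bilinR (reflR v x) v = - bilinR x v := by
    rw [bR_comm, bR_refl, bR_comm v x]; field_simp; ring
  conv_lhs => rw [reflR, this]
  rw [reflR]
  ext i
  simp only [Pi.sub_apply, Pi.smul_apply, smul_eq_mul]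
  ring

lemma bR_refl_refl {N : ℕ} (v x y : Fin N → ℝ) (h : bilinR v v ≠ 0) :
    bilinR (reflR v x) (reflR v y) = bilinR x y := by
  rw [bR_refl', refl_refl v y h]

lemma refl_conj {N : ℕ} (v w x : Fin N → ℝ) (h : bilinR v v ≠ 0) :
    reflR (reflR v w) (reflR v x) = reflR v (reflR w x) := by
  rw [reflR, bR_refl_refl _ _ _ h, bR_refl_refl _ _ _ h]
  generalize hc : 2 * bilinR x w / bilinR w w = c
  have : reflR w x = x - c • w := by rw [reflR, hc]
  rw [this, reflR, reflR, reflR, bR_comm (x - c • w), bR_sub, bR_smul, bR_comm v x, bR_comm v w]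
  ext i
  simp only [Pi.sub_apply, Pi.smul_apply, smul_eq_mul]
  ring

lemma refl_self {N : ℕ} (v : Fin N → ℝ) (h : bilinR v v ≠ 0) : reflR v v = -v := by
  rw [reflR, mul_div_assoc, div_self h]
  ext i; simp; ring

lemma sum_refl {N : ℕ} (R : Finset (Fin N → ℝ)) (hR0 : (0 : Fin N → ℝ) ∉ R)
    (hRrefl : ∀ u ∈ R, ∀ x ∈ R, reflR u x ∈ R) (v : Fin N → ℝ) (hv : v ∈ R)
    (φ : (Fin N → ℝ) → ℂ) : ∑ x ∈ R, φ (reflR v x) = ∑ x ∈ R, φ x := by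
  have h : bilinR v v ≠ 0 := fun h => hR0 (bR_self h ▸ hv)
  refine Finset.sum_bij' (fun x _ => reflR v x) (fun x _ => reflR v x) ?_ ?_ ?_ ?_ ?_
  · exact fun x hx => hRrefl v hv x hx
  · exact fun x hx => hRrefl v hv x hx
  · exact fun x _ => refl_refl v x h
  · exact fun x _ => refl_refl v x h
  · exact fun x _ => rfl

lemma telescope {N : ℕ} (z v w : Fin N → ℝ) (c : ℂ) (hv : bilinR z v ≠ 0) (hw : bilinR z w ≠ 0)
    (hw0 : bilinR w w ≠ 0)
    (hc : bilinR v v • w - bilinR v w • v = 0 → c = 0)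
    (h : (Fin N → ℝ) → (Fin N → ℝ) → ℝ)
    (hh : ∀ v w, h v w = (bilinR v v * bilinR z w - bilinR v w * bilinR z v) /
      ((bilinR w w * bilinR z v ^ 2 - 2 * bilinR v w * bilinR z v * bilinR z w
        + bilinR v v * bilinR z w ^ 2) * bilinR z v)) :
    c / (bilinR z v * bilinR z w) = c * h v w + c * h w (reflR w v) := by
  have e1 : bilinR w (reflR w v) = - bilinR v w := by
    rw [bR_refl, bR_comm w v]; field_simp; ring
  have e2 : bilinR (reflR w v) (reflR w v) = bilinR v v := bR_refl_refl _ _ _ hw0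
  have e3 := bR_refl z w v
  set y := bilinR v v • w - bilinR v w • v with hy
  have ey : bilinR z y = bilinR v v * bilinR z w - bilinR v w * bilinR z v := by
    rw [hy, bR_sub, bR_smul, bR_smul]
  have eyy : bilinR y y = bilinR v v * (bilinR v v * bilinR w w - bilinR v w ^ 2) := by
    have h1 : bilinR w y = bilinR v v * bilinR w w - bilinR v w ^ 2 := by
      rw [hy, bR_sub, bR_smul, bR_smul, bR_comm w v]; ring
    have h2 : bilinR v y = 0 := by
      rw [hy, bR_sub, bR_smul, bR_smul]; ring
    conv_lhs => rw [hy, bR_comm, ← hy, bR_sub, bR_smul, bR_smul]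
    rw [bR_comm y w, bR_comm y v, h1, h2]; ring
  by_cases hc0 : c = 0
  · simp [hc0]
  have hy0 : bilinR y y ≠ 0 := fun h => hc0 (hc (bR_self h))
  have hvv : bilinR v v ≠ 0 := by
    intro h; rw [h] at eyy; simp at eyy; exact hy0 eyy
  have nn : ∀ x : Fin N → ℝ, 0 ≤ bilinR x x := fun x =>
    Finset.sum_nonneg fun i _ => mul_self_nonneg _
  have hQ : bilinR w w * bilinR z v ^ 2 - 2 * bilinR v w * bilinR z v * bilinR z w
        + bilinR v v * bilinR z w ^ 2 ≠ 0 := by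
    intro hq
    have k : bilinR v v * bilinR z y ^ 2 + bilinR y y * bilinR z v ^ 2 = 0 := by
      rw [ey, eyy]; linear_combination (bilinR v v) ^ 2 * hq
    have p1 : 0 < bilinR y y * bilinR z v ^ 2 :=
      mul_pos (lt_of_le_of_ne (nn y) hy0.symm) (by positivity)
    have p2 : 0 ≤ bilinR v v * bilinR z y ^ 2 := mul_nonneg (nn v) (sq_nonneg _)
    linarith
  have key : 1 / (bilinR z v * bilinR z w) = h v w + h w (reflR w v) := by
    rw [hh, hh, e1, e2, e3]
    have q2 : bilinR v v * bilinR z w ^ 2 - 2 * -bilinR v w * bilinR z w *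
      (bilinR z v - 2 * bilinR v w / bilinR w w * bilinR z w) + bilinR w w *
      (bilinR z v - 2 * bilinR v w / bilinR w w * bilinR z w) ^ 2 =
       bilinR w w * bilinR z v ^ 2 - 2 * bilinR v w * bilinR z v * bilinR z w
        + bilinR v v * bilinR z w ^ 2 := by field_simp; ring
    have q3 : bilinR w w * (bilinR z v - 2 * bilinR v w / bilinR w w * bilinR z w)
       - -bilinR v w * bilinR z w = bilinR w w * bilinR z v - bilinR v w * bilinR z w := by
      field_simp; ring
    rw [q2, q3]
    generalize hQd : bilinR w w * bilinR z v ^ 2 - 2 * bilinR v w * bilinR z v * bilinR z w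
        + bilinR v v * bilinR z w ^ 2 = q at hQ ⊢
    field_simp
    rw [← hQd]
    ring
  rw [← mul_add, ← Complex.ofReal_add, ← key]
  push_cast
  ring

lemma core {N : ℕ} (R : Finset (Fin N → ℝ)) (hR0 : (0 : Fin N → ℝ) ∉ R)
    (hRrefl : ∀ u ∈ R, ∀ x ∈ R, reflR u x ∈ R) (z : Fin N → ℝ)
    (hz : ∀ v ∈ R, bilinR z v ≠ 0) (c : (Fin N → ℝ) → (Fin N → ℝ) → ℂ)
    (hc1 : ∀ v ∈ R, ∀ w ∈ R, c w v = - c v w)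
    (hc2 : ∀ v ∈ R, ∀ w ∈ R, c v (reflR v w) = c v w)
    (hc3 : ∀ v ∈ R, ∀ w ∈ R, bilinR v v • w - bilinR v w • v = 0 → c v w = 0)
    (F : (Fin N → ℝ) → ℂ) :
    ∑ v ∈ R, ∑ w ∈ R, c v w * (((F z - F (reflR w z)) / bilinR z w -
      (F (reflR v z) - F (reflR w (reflR v z))) / bilinR (reflR v z) w) / bilinR z v) = 0 := by
  have h0 : ∀ v ∈ R, bilinR v v ≠ 0 := fun v hv h => hR0 (bR_self h ▸ hv)
  have s1 : ∑ v ∈ R, ∑ w ∈ R, c v w * (((F z - F (reflR w z)) / bilinR z w -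
      (F (reflR v z) - F (reflR w (reflR v z))) / bilinR (reflR v z) w) / bilinR z v) =
      ∑ v ∈ R, ∑ w ∈ R, c v w / (bilinR z v * bilinR z w) * (F z - F (reflR w z)) -
      ∑ v ∈ R, ∑ w ∈ R, c v w / (bilinR z v * bilinR z w) *
        (F (reflR v z) - F (reflR v (reflR w z))) := by
    rw [← Finset.sum_sub_distrib]
    refine Finset.sum_congr rfl fun v hv => ?_
    rw [← sum_refl R hR0 hRrefl v hv (fun w => c v w / (bilinR z v * bilinR z w) *
        (F (reflR v z) - F (reflR v (reflR w z)))), ← Finset.sum_sub_distrib]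
    refine Finset.sum_congr rfl fun w hw => ?_
    have : reflR v (reflR (reflR v w) z) = reflR w (reflR v z) := by
      rw [← refl_conj _ _ _ (h0 v hv), refl_refl v w (h0 v hv)]
    simp only [this, hc2 v hv w hw, bR_refl' z v w]
    simp only [div_eq_mul_inv, mul_inv]
    ring
  have swap : ∀ G : (Fin N → ℝ) → (Fin N → ℝ) → ℂ,
      ∑ v ∈ R, ∑ w ∈ R, c v w / (bilinR z v * bilinR z w) * G v w =
      - ∑ v ∈ R, ∑ w ∈ R, c v w / (bilinR z v * bilinR z w) * G w v := by
    intro G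
    rw [Finset.sum_comm, ← Finset.sum_neg_distrib]
    refine Finset.sum_congr rfl fun v hv => ?_
    rw [← Finset.sum_neg_distrib]
    refine Finset.sum_congr rfl fun w hw => ?_
    rw [hc1 v hv w hw, mul_comm (bilinR z w : ℂ)]
    ring
  have s2 : ∑ v ∈ R, ∑ w ∈ R, c v w / (bilinR z v * bilinR z w) * F z = 0 := by
    have := swap fun _ _ => F z
    exact self_eq_neg.mp this
  have s3 := swap fun v _ => F (reflR v z)
  have s4 : ∑ v ∈ R, ∑ w ∈ R, c v w / (bilinR z v * bilinR z w) * F (reflR v (reflR w z)) = 0 := by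
    obtain ⟨h, hh⟩ : ∃ h : (Fin N → ℝ) → (Fin N → ℝ) → ℝ, ∀ v w, h v w =
      (bilinR v v * bilinR z w - bilinR v w * bilinR z v) /
      ((bilinR w w * bilinR z v ^ 2 - 2 * bilinR v w * bilinR z v * bilinR z w
        + bilinR v v * bilinR z w ^ 2) * bilinR z v) := ⟨_, fun _ _ => rfl⟩
    have a1 : ∑ v ∈ R, ∑ w ∈ R, c v w / (bilinR z v * bilinR z w) * F (reflR v (reflR w z)) =
        ∑ v ∈ R, ∑ w ∈ R, c v w * h v w * F (reflR v (reflR w z)) +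
        ∑ v ∈ R, ∑ w ∈ R, c v w * h w (reflR w v) * F (reflR v (reflR w z)) := by
      rw [← Finset.sum_add_distrib]
      refine Finset.sum_congr rfl fun v hv => ?_
      rw [← Finset.sum_add_distrib]
      refine Finset.sum_congr rfl fun w hw => ?_
      rw [telescope z v w (c v w) (hz v hv) (hz w hw) (h0 w hw) (hc3 v hv w hw) h hh]
      ring
    rw [a1, Finset.sum_comm (f := fun v w => c v w * h w (reflR w v) * F (reflR v (reflR w z))),
      ← Finset.sum_add_distrib]
    refine Finset.sum_eq_zero fun v hv => ?_
    rw [← sum_refl R hR0 hRrefl v hv (fun w => c v w * h v w * F (reflR v (reflR w z))),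
      ← Finset.sum_add_distrib]
    refine Finset.sum_eq_zero fun w hw => ?_
    have : reflR v (reflR (reflR v w) z) = reflR w (reflR v z) := by
      rw [← refl_conj _ _ _ (h0 v hv), refl_refl v w (h0 v hv)]
    simp only [this, hc2 v hv w hw, hc1 v hv w hw]
    ring
  rw [s1]
  simp only [mul_sub, Finset.sum_sub_distrib]
  rw [s2, s3, s4]
  ring

def dirD {N : ℕ} (u : Fin N → ℂ) (p : MvPolynomial (Fin N) ℂ) : MvPolynomial (Fin N) ℂ :=
  ∑ j, C ((starRingEnd ℂ) (u j)) * pderiv j p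

lemma dirD_add {N : ℕ} (u : Fin N → ℂ) (p q : MvPolynomial (Fin N) ℂ) :
    dirD u (p + q) = dirD u p + dirD u q := by
  simp only [dirD, map_add, mul_add, Finset.sum_add_distrib]

lemma dirD_mul {N : ℕ} (u : Fin N → ℂ) (p q : MvPolynomial (Fin N) ℂ) :
    dirD u (p * q) = p * dirD u q + q * dirD u p := by
  simp only [dirD, Finset.mul_sum, ← Finset.sum_add_distrib, Derivation.leibniz, smul_eq_mul]
  exact Finset.sum_congr rfl fun _ _ => by ring

lemma dirD_C {N : ℕ} (u : Fin N → ℂ) (a : ℂ) : dirD u (C a) = 0 := by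
  simp [dirD]

lemma dirD_Cmul {N : ℕ} (u : Fin N → ℂ) (a : ℂ) (p : MvPolynomial (Fin N) ℂ) :
    dirD u (C a * p) = C a * dirD u p := by
  rw [dirD_mul, dirD_C]; ring

lemma dirD_sum {N : ℕ} (u : Fin N → ℂ) {ι : Type*} (s : Finset ι)
    (p : ι → MvPolynomial (Fin N) ℂ) : dirD u (∑ i ∈ s, p i) = ∑ i ∈ s, dirD u (p i) := by
  simp only [dirD, map_sum, Finset.mul_sum]
  rw [Finset.sum_comm]

lemma dirD_sub {N : ℕ} (u : Fin N → ℂ) (p q : MvPolynomial (Fin N) ℂ) :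
    dirD u (p - q) = dirD u p - dirD u q := by
  simp only [dirD, map_sub, mul_sub, Finset.sum_sub_distrib]

lemma dirD_X {N : ℕ} (u : Fin N → ℂ) (j : Fin N) : dirD u (X j) = C ((starRingEnd ℂ) (u j)) := by
  simp [dirD, pderiv_X, Pi.single_apply]

lemma dirD_lin {N : ℕ} (u : Fin N → ℂ) (v : Fin N → ℝ) :
    dirD u (linPoly v) = C (hermC (cplx v) u) := by
  simp only [linPoly, dirD_sum, dirD_Cmul, dirD_X, hermC, cplx, map_sum, map_mul]

lemma dirD_comm {N : ℕ} (t u : Fin N → ℂ) (p : MvPolynomial (Fin N) ℂ) :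
    dirD t (dirD u p) = dirD u (dirD t p) := by
  have pc : ∀ i j : Fin N, pderiv i (pderiv j p) = pderiv j (pderiv i p) := by
    intro i j
    have : ⁅(pderiv i : Derivation ℂ (MvPolynomial (Fin N) ℂ) (MvPolynomial (Fin N) ℂ)),
        (pderiv j : Derivation ℂ (MvPolynomial (Fin N) ℂ) (MvPolynomial (Fin N) ℂ))⁆ = 0 := by
      apply MvPolynomial.derivation_ext
      intro k
      rw [Derivation.commutator_apply]
      simp only [pderiv_X, Pi.single_apply]
      split_ifs <;> simp
    have h := congrArg (fun d => d p) this
    simp only [Derivation.commutator_apply] at h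
    exact sub_eq_zero.mp h
  unfold dirD
  simp only [map_sum, Finset.mul_sum, Derivation.leibniz, smul_eq_mul, pderiv_C, mul_zero, add_zero]
  rw [Finset.sum_comm]
  refine Finset.sum_congr rfl fun i _ => Finset.sum_congr rfl fun j _ => ?_
  rw [pc]; ring

lemma dirD_aeval {N : ℕ} (u : Fin N → ℂ) (g : Fin N → MvPolynomial (Fin N) ℂ)
    (p : MvPolynomial (Fin N) ℂ) :
    dirD u (aeval g p) = ∑ j, aeval g (pderiv j p) * dirD u (g j) := by
  induction p using MvPolynomial.induction_on with
  | C a => simp [dirD_C, algebraMap_eq]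
  | add p q hp hq =>
    simp only [map_add, dirD_add, hp, hq, add_mul, Finset.sum_add_distrib]
  | mul_X p i hp =>
    simp only [map_mul, aeval_X, dirD_mul, hp, Derivation.leibniz, smul_eq_mul, pderiv_X,
      map_add, add_mul, Finset.sum_add_distrib, Finset.mul_sum]
    refine congrArg₂ (· + ·) ?_ ?_
    · rw [Finset.sum_eq_single i]
      · rw [Pi.single_eq_same, map_one, mul_one]
      · intro b _ hb
        rw [Pi.single_eq_of_ne' hb, map_zero, mul_zero, zero_mul]
      · exact fun h => absurd (Finset.mem_univ i) h
    · exact Finset.sum_congr rfl fun _ _ => by ring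

lemma lin_ne {N : ℕ} (v : Fin N → ℝ) (hv : v ≠ 0) : linPoly v ≠ 0 := by
  intro h
  apply hv
  ext i
  have := congrArg (eval (Pi.single i 1)) h
  simpa [linPoly, Pi.single_apply] using this

lemma rho_spec {N : ℕ} (v : Fin N → ℝ) (p : MvPolynomial (Fin N) ℂ) :
    linPoly v * rhoPoly v p = p - reflPoly v p := by
  have h : linPoly v ∣ (p - reflPoly v p) := by
    rw [← Ideal.mem_span_singleton, ← Ideal.Quotient.eq]
    have : (Ideal.Quotient.mkₐ ℂ (Ideal.span {linPoly v})) =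
      (Ideal.Quotient.mkₐ ℂ (Ideal.span {linPoly v})).comp
        (aeval (fun j => X j - C (((2 * v j / bilinR v v : ℝ) : ℂ)) * linPoly v)) := by
      apply MvPolynomial.algHom_ext
      intro j
      rw [AlgHom.comp_apply, aeval_X]
      simp only [Ideal.Quotient.mkₐ_eq_mk]
      rw [Ideal.Quotient.eq, Ideal.mem_span_singleton]
      exact ⟨C (((2 * v j / bilinR v v : ℝ) : ℂ)), by ring⟩
    exact congrArg (fun φ => φ p) this
  unfold rhoPoly
  rw [dif_pos h]
  exact h.choose_spec.symm

lemma refl_add {N : ℕ} (v : Fin N → ℝ) (p q : MvPolynomial (Fin N) ℂ) :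
    reflPoly v (p + q) = reflPoly v p + reflPoly v q := map_add _ _ _

lemma refl_Cmul {N : ℕ} (v : Fin N → ℝ) (a : ℂ) (q : MvPolynomial (Fin N) ℂ) :
    reflPoly v (C a * q) = C a * reflPoly v q := by
  simp [reflPoly, algebraMap_eq]

lemma rho_add {N : ℕ} (v : Fin N → ℝ) (hv : v ≠ 0) (p q : MvPolynomial (Fin N) ℂ) :
    rhoPoly v (p + q) = rhoPoly v p + rhoPoly v q := by
  apply mul_left_cancel₀ (lin_ne v hv)
  rw [mul_add, rho_spec, rho_spec, rho_spec, refl_add]; ring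

lemma rho_Cmul {N : ℕ} (v : Fin N → ℝ) (hv : v ≠ 0) (a : ℂ) (q : MvPolynomial (Fin N) ℂ) :
    rhoPoly v (C a * q) = C a * rhoPoly v q := by
  apply mul_left_cancel₀ (lin_ne v hv)
  rw [mul_left_comm, rho_spec, rho_spec, refl_Cmul]; ring

lemma rho_sum {N : ℕ} (v : Fin N → ℝ) (hv : v ≠ 0) {ι : Type*} (s : Finset ι)
    (p : ι → MvPolynomial (Fin N) ℂ) : rhoPoly v (∑ i ∈ s, p i) = ∑ i ∈ s, rhoPoly v (p i) := by
  let φ : MvPolynomial (Fin N) ℂ →+ MvPolynomial (Fin N) ℂ :=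
    AddMonoidHom.mk' (rhoPoly v) (rho_add v hv)
  exact map_sum φ p s

lemma rho_dirD {N : ℕ} (v : Fin N → ℝ) (u : Fin N → ℂ) (p : MvPolynomial (Fin N) ℂ) :
    linPoly v * (dirD u (rhoPoly v p) - rhoPoly v (dirD u p)) = C (hermC (cplx v) u) *
      (∑ j, C (((2 * v j / bilinR v v : ℝ) : ℂ)) * reflPoly v (pderiv j p) - rhoPoly v p) := by
  have h1 := congrArg (dirD u) (rho_spec v p)
  rw [dirD_mul, dirD_lin, dirD_sub] at h1
  have h2 := rho_spec v (dirD u p)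
  have h3 : dirD u (reflPoly v p) = reflPoly v (dirD u p) - C (hermC (cplx v) u) *
      ∑ j, C (((2 * v j / bilinR v v : ℝ) : ℂ)) * reflPoly v (pderiv j p) := by
    rw [reflPoly, dirD_aeval, reflPoly]
    conv_rhs => rw [dirD]
    simp only [map_sum, Finset.mul_sum, ← Finset.sum_sub_distrib, dirD_sub, dirD_Cmul, dirD_X,
      dirD_lin, map_mul, aeval_C, algebraMap_eq, reflPoly]
    exact Finset.sum_congr rfl fun _ _ => by ring
  rw [h3] at h1
  linear_combination h1 - h2

lemma rho_dirD_symm {N : ℕ} (v : Fin N → ℝ) (hv : v ≠ 0) (t u : Fin N → ℂ)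
    (p : MvPolynomial (Fin N) ℂ) :
    C (hermC (cplx v) t) * (dirD u (rhoPoly v p) - rhoPoly v (dirD u p)) =
    C (hermC (cplx v) u) * (dirD t (rhoPoly v p) - rhoPoly v (dirD t p)) := by
  apply mul_left_cancel₀ (lin_ne v hv)
  linear_combination C (hermC (cplx v) t) * rho_dirD v u p - C (hermC (cplx v) u) * rho_dirD v t p

lemma eval_lin {N : ℕ} (v z : Fin N → ℝ) : eval (cplx z) (linPoly v) = (bilinR z v : ℂ) := by
  simp [linPoly, bilinR, cplx, mul_comm]

lemma eval_refl {N : ℕ} (v z : Fin N → ℝ) (p : MvPolynomial (Fin N) ℂ) :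
    eval (cplx z) (reflPoly v p) = eval (cplx (reflR v z)) p := by
  have : ((aeval (cplx z)).comp
        (aeval (fun j => X j - C (((2 * v j / bilinR v v : ℝ) : ℂ)) * linPoly v)) :
        MvPolynomial (Fin N) ℂ →ₐ[ℂ] ℂ) = aeval (cplx (reflR v z)) := by
    apply MvPolynomial.algHom_ext
    intro j
    have := eval_lin v z
    rw [← coe_aeval_eq_eval, RingHom.coe_coe] at this
    simp only [AlgHom.comp_apply, aeval_X, map_sub, map_mul, aeval_C, this]
    simp [cplx, reflR]
    ring
  have h := congrArg (fun φ => φ p) this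
  simpa [reflPoly, coe_aeval_eq_eval] using h

lemma eval_rho {N : ℕ} (v z : Fin N → ℝ) (hz : bilinR z v ≠ 0) (p : MvPolynomial (Fin N) ℂ) :
    eval (cplx z) (rhoPoly v p) =
      (eval (cplx z) p - eval (cplx (reflR v z)) p) / bilinR z v := by
  have h := congrArg (eval (cplx z)) (rho_spec v p)
  rw [map_mul, map_sub, eval_lin, eval_refl] at h
  rw [eq_div_iff (by exact_mod_cast hz), ← h, mul_comm]

lemma rho_neg {N : ℕ} (v : Fin N → ℝ) (hv : v ≠ 0) (p : MvPolynomial (Fin N) ℂ) :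
    rhoPoly (-v) p = - rhoPoly v p := by
  have hl : linPoly (-v) = - linPoly v := by simp [linPoly]
  have hr : reflPoly (-v) p = reflPoly v p := by
    unfold reflPoly
    rw [hl]
    congr 2
    ext1 j
    have : bilinR (-v) (-v) = bilinR v v := by simp [bilinR]
    rw [this]
    simp [neg_div]
  apply mul_left_cancel₀ (lin_ne v hv)
  have := rho_spec (-v) p
  rw [hl, hr, ← rho_spec v p] at this
  linear_combination -this

lemma sum_pos {N : ℕ} {M : Type*} [AddCommMonoid M] (R Rp : Finset (Fin N → ℝ))
    (hRpos : ∀ u : Fin N → ℝ, u ∈ R ↔ u ∈ Rp ∨ -u ∈ Rp)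
    (hRpdisj : ∀ u ∈ Rp, -u ∉ Rp) (φ : (Fin N → ℝ) → M) (hφ : ∀ v ∈ Rp, φ (-v) = φ v) :
    ∑ v ∈ R, φ v = 2 • ∑ v ∈ Rp, φ v := by
  classical
  have : R = Rp ∪ Rp.image (fun v => -v) := by
    ext x
    rw [hRpos, Finset.mem_union, Finset.mem_image]
    refine or_congr Iff.rfl ⟨fun h => ⟨-x, h, neg_neg x⟩, ?_⟩
    rintro ⟨y, hy, rfl⟩
    simpa using hy
  rw [this, Finset.sum_union, Finset.sum_image (fun _ _ _ _ h => neg_injective h), two_smul,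
    Finset.sum_congr rfl hφ]
  rw [Finset.disjoint_left]
  intro x hx hx'
  obtain ⟨y, hy, rfl⟩ := Finset.mem_image.mp hx'
  exact hRpdisj y hy hx

lemma eq_zero_of_generic {N : ℕ} (R : Finset (Fin N → ℝ)) (hR0 : (0 : Fin N → ℝ) ∉ R)
    (p : MvPolynomial (Fin N) ℂ)
    (h : ∀ z : Fin N → ℝ, (∀ v ∈ R, bilinR z v ≠ 0) → eval (cplx z) p = 0) : p = 0 := by
  have h1 : (∏ v ∈ R, linPoly v) * p = 0 := by
    apply MvPolynomial.funext_set (fun _ => Set.range ((↑) : ℝ → ℂ))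
    · intro i
      exact Set.infinite_range_of_injective Complex.ofReal_injective
    · intro x hx
      choose z hz using fun i => hx i (Set.mem_univ i)
      have : x = cplx z := funext fun i => (hz i).symm
      rw [this, map_mul, map_prod, map_zero]
      by_cases hg : ∀ v ∈ R, bilinR z v ≠ 0
      · rw [h z hg, mul_zero]
      · push Not at hg
        obtain ⟨v, hv, h0⟩ := hg
        rw [Finset.prod_eq_zero hv (by rw [eval_lin, h0]; simp), zero_mul]
  refine (mul_eq_zero.mp h1).resolve_left (Finset.prod_ne_zero_iff.mpr fun v hv => lin_ne v ?_)
  rintro rfl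
  exact hR0 hv

lemma herm_neg {N : ℕ} (v : Fin N → ℝ) (u : Fin N → ℂ) :
    hermC (cplx (-v)) u = - hermC (cplx v) u := by
  simp [hermC, cplx]

lemma herm_sub {N : ℕ} (v w : Fin N → ℝ) (u : Fin N → ℂ) :
    hermC (cplx (v - w)) u = hermC (cplx v) u - hermC (cplx w) u := by
  simp [hermC, cplx, sub_mul]

lemma herm_smul {N : ℕ} (a : ℝ) (v : Fin N → ℝ) (u : Fin N → ℂ) :
    hermC (cplx (a • v)) u = a * hermC (cplx v) u := by
  simp [hermC, cplx, Finset.mul_sum, mul_assoc]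

lemma second_order {N : ℕ} (R Rp : Finset (Fin N → ℝ)) (κ : (Fin N → ℝ) → ℂ)
    (hR0 : (0 : Fin N → ℝ) ∉ R)
    (hRrefl : ∀ u ∈ R, ∀ x ∈ R, reflR u x ∈ R)
    (hRpos : ∀ u : Fin N → ℝ, u ∈ R ↔ u ∈ Rp ∨ -u ∈ Rp)
    (hRpdisj : ∀ u ∈ Rp, -u ∉ Rp)
    (hκ : ∀ u ∈ R, ∀ w ∈ R, κ (reflR w u) = κ u)
    (t u : Fin N → ℂ) (f : MvPolynomial (Fin N) ℂ) :
    ∑ v ∈ Rp, ∑ w ∈ Rp, C (κ v * κ w * (hermC (cplx v) t * hermC (cplx w) u -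
      hermC (cplx v) u * hermC (cplx w) t)) * rhoPoly v (rhoPoly w f) = 0 := by
  have hne : ∀ v ∈ R, v ≠ 0 := fun v hv h => hR0 (h ▸ hv)
  have h0 : ∀ v ∈ R, bilinR v v ≠ 0 := fun v hv h => hR0 (bR_self h ▸ hv)
  have hp : ∀ v ∈ Rp, v ∈ R := fun v hv => (hRpos v).mpr (Or.inl hv)
  have hκn : ∀ v ∈ R, κ (-v) = κ v := fun v hv => by
    rw [← refl_self v (h0 v hv), hκ v hv v hv]
  have rneg : ∀ v ∈ R, ∀ q : MvPolynomial (Fin N) ℂ, rhoPoly v (-q) = - rhoPoly v q := by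
    intro v hv q
    have := rho_Cmul v (hne v hv) (-1) q
    simpa using this
  have hR : ∑ v ∈ R, ∑ w ∈ R, C (κ v * κ w * (hermC (cplx v) t * hermC (cplx w) u -
      hermC (cplx v) u * hermC (cplx w) t)) * rhoPoly v (rhoPoly w f) = 0 := by
    apply eq_zero_of_generic R hR0
    intro z hz
    have := core R hR0 hRrefl z hz (fun v w => κ v * κ w * (hermC (cplx v) t * hermC (cplx w) u -
      hermC (cplx v) u * hermC (cplx w) t)) ?_ ?_ ?_ (fun z => eval (cplx z) f)
    · rw [← this, map_sum]
      refine Finset.sum_congr rfl fun v hv => ?_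
      rw [map_sum]
      refine Finset.sum_congr rfl fun w hw => ?_
      rw [map_mul, eval_C, eval_rho v z (hz v hv), eval_rho w z (hz w hw), eval_rho w (reflR v z)]
      rw [bR_refl']
      exact hz _ (hRrefl v hv w hw)
    · intro v _ w _; ring
    · intro v hv w hw
      simp only [hκ w hw v hv]
      rw [reflR, herm_sub, herm_sub, herm_smul, herm_smul]
      ring
    · intro v hv w hw h
      have e : ∀ s, (bilinR v v : ℂ) * hermC (cplx w) s = bilinR v w * hermC (cplx v) s := by
        intro s
        rw [← herm_smul, ← herm_smul, sub_eq_zero.mp h]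
      have hvv : (bilinR v v : ℂ) ≠ 0 := by exact_mod_cast h0 v hv
      apply mul_left_cancel₀ hvv
      linear_combination κ v * κ w * hermC (cplx v) t * e u - κ v * κ w * hermC (cplx v) u * e t
  rw [sum_pos R Rp hRpos hRpdisj] at hR
  · have h2 : ∀ v ∈ Rp, ∑ w ∈ R, C (κ v * κ w * (hermC (cplx v) t * hermC (cplx w) u -
      hermC (cplx v) u * hermC (cplx w) t)) * rhoPoly v (rhoPoly w f) =
      2 • ∑ w ∈ Rp, C (κ v * κ w * (hermC (cplx v) t * hermC (cplx w) u -
      hermC (cplx v) u * hermC (cplx w) t)) * rhoPoly v (rhoPoly w f) := by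
      intro v hv
      apply sum_pos R Rp hRpos hRpdisj
      intro w hw
      rw [hκn w (hp w hw), herm_neg, herm_neg, rho_neg w (hne w (hp w hw)), rneg v (hp v hv),
        mul_neg, ← neg_mul, ← C_neg]
      congr 2
      ring
    rw [Finset.sum_congr rfl h2, ← Finset.smul_sum, smul_smul] at hR
    exact (smul_eq_zero.mp hR).resolve_left (by norm_num)
  · intro v hv
    refine Finset.sum_congr rfl fun w hw => ?_
    rw [hκn v (hp v hv), herm_neg, herm_neg, rho_neg v (hne v (hp v hv)), mul_neg, ← neg_mul,
      ← C_neg]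
    congr 2
    ring

/-- main theorem: commutativity of complex Dunkl operators: for a root
system `R ⊂ ℂ^N` with `R ⊂ ℝ^N`, a positive subsystem `R₊`, and a multiplicity
function `κ` invariant under the complex Coxeter group (equivalently, under its
generating reflections), the complex Dunkl operators commute:
`𝒟_t 𝒟_u f(z) = 𝒟_u 𝒟_t f(z)` for all `t, u ∈ ℂ^N`, all polynomials `f`, and
every `z ∈ ℂ^N`. -/
theorem stmt9 {N : ℕ} (R Rp : Finset (Fin N → ℝ)) (κ : (Fin N → ℝ) → ℂ)
    (hR0 : (0 : Fin N → ℝ) ∉ R)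
    (hRrefl : ∀ u ∈ R, ∀ x ∈ R, reflR u x ∈ R)
    (hRline : ∀ u ∈ R, ∀ x ∈ R, (∃ c : ℝ, x = c • u) → x = u ∨ x = -u)
    (hRneg : ∀ u ∈ R, -u ∈ R)
    (hRpos : ∀ u : Fin N → ℝ, u ∈ R ↔ u ∈ Rp ∨ -u ∈ Rp)
    (hRpdisj : ∀ u ∈ Rp, -u ∉ Rp)
    (hκ : ∀ u ∈ R, ∀ w ∈ R, κ (reflR w u) = κ u)
    (t u : Fin N → ℂ) (f : MvPolynomial (Fin N) ℂ) :
    ∀ z : Fin N → ℂ,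
      eval z (dunklU Rp κ t (dunklU Rp κ u f)) = eval z (dunklU Rp κ u (dunklU Rp κ t f)) := by
  intro z
  have hne : ∀ v ∈ Rp, v ≠ 0 := fun v hv h => hR0 (h ▸ (hRpos v).mpr (Or.inl hv))
  have key : ∀ s r : Fin N → ℂ, dunklU Rp κ s (dunklU Rp κ r f) = dirD s (dirD r f) +
      ∑ v ∈ Rp, C (κ v) * (C (hermC (cplx v) r) * dirD s (rhoPoly v f) +
        C (hermC (cplx v) s) * rhoPoly v (dirD r f)) +
      ∑ v ∈ Rp, ∑ w ∈ Rp, C (κ v * κ w * (hermC (cplx v) s * hermC (cplx w) r)) *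
        rhoPoly v (rhoPoly w f) := by
    intro s r
    have e : ∀ r p, dunklU Rp κ r p =
      dirD r p + ∑ v ∈ Rp, C (κ v * hermC (cplx v) r) * rhoPoly v p := fun _ _ => rfl
    rw [e s, e r, dirD_add, dirD_sum]
    simp only [dirD_Cmul]
    have h1 : ∀ v ∈ Rp, C (κ v * hermC (cplx v) s) * rhoPoly v
        (dirD r f + ∑ w ∈ Rp, C (κ w * hermC (cplx w) r) * rhoPoly w f) =
        C (κ v * hermC (cplx v) s) * rhoPoly v (dirD r f) +
        ∑ w ∈ Rp, C (κ v * κ w * (hermC (cplx v) s * hermC (cplx w) r)) *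
          rhoPoly v (rhoPoly w f) := by
      intro v hv
      rw [rho_add v (hne v hv), rho_sum v (hne v hv), mul_add, Finset.mul_sum]
      refine congrArg₂ (· + ·) rfl ?_
      refine Finset.sum_congr rfl fun w _ => ?_
      rw [rho_Cmul v (hne v hv)]
      simp only [map_mul]
      ring
    rw [Finset.sum_congr rfl h1]
    simp only [mul_add, Finset.sum_add_distrib, map_mul, mul_assoc]
    ring
  have h2 := second_order R Rp κ hR0 hRrefl hRpos hRpdisj hκ t u f
  have h3 : ∑ v ∈ Rp, C (κ v) * (C (hermC (cplx v) u) * dirD t (rhoPoly v f) +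
        C (hermC (cplx v) t) * rhoPoly v (dirD u f)) =
      ∑ v ∈ Rp, C (κ v) * (C (hermC (cplx v) t) * dirD u (rhoPoly v f) +
        C (hermC (cplx v) u) * rhoPoly v (dirD t f)) := by
    refine Finset.sum_congr rfl fun v hv => ?_
    linear_combination - C (κ v) * rho_dirD_symm v (hne v hv) t u f
  have h4 : ∑ v ∈ Rp, ∑ w ∈ Rp, C (κ v * κ w * (hermC (cplx v) t * hermC (cplx w) u)) *
        rhoPoly v (rhoPoly w f) =
      ∑ v ∈ Rp, ∑ w ∈ Rp, C (κ v * κ w * (hermC (cplx v) u * hermC (cplx w) t)) *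
        rhoPoly v (rhoPoly w f) := by
    rw [← sub_eq_zero, ← h2]
    simp only [← Finset.sum_sub_distrib, ← sub_mul, ← map_sub, ← mul_sub]
  rw [key t u, key u t, h3, h4, dirD_comm]
end
end
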